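/- arXiv:2404.04551 — 8 statements merged into one kernel-verified Lean document; each statement's English description precedes it below -/
import Mathlib

section
/- For every irrational real number θ and all integers j > i ≥ 0, one has gcd(q_{2i}, q_{2i+2}, …, q_{2j}) = gcd(q_{2i}, a_{2i+2}, a_{2i+4}, …, a_{2j}). Consequently, for every i ≥ 0, the stable value cᵢ(θ) of gcd(q_{2i}, …, q_{2j}) as j → ∞ equals the stable value of gcd(q_{2i}, a_{2i+2}, …, a_{2j}) as j → ∞. -/
/-- The Gauss–iteration auxiliary sequence of complete quotients of `θ`:
`θ₀ = θ`, `θ_{n+1} = 1 / fract θₙ`. -/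
noncomputable def cfAux (θ : ℝ) : ℕ → ℝ
  | 0 => θ
  | n + 1 => (Int.fract (cfAux θ n))⁻¹

/-- The `n`-th partial quotient `aₙ` of the regular continued fraction of `θ`. -/
noncomputable def cfA (θ : ℝ) (n : ℕ) : ℤ := ⌊cfAux θ n⌋

/-- The numerator `pₙ` of the `n`-th convergent of `θ`:
`p₀ = a₀`, `p₁ = a₁·a₀ + 1`, `pₙ = aₙ·pₙ₋₁ + pₙ₋₂` (so `p₋₁ = 1`). -/
noncomputable def cfP (θ : ℝ) : ℕ → ℤ
  | 0 => cfA θ 0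
  | 1 => cfA θ 1 * cfA θ 0 + 1
  | n + 2 => cfA θ (n + 2) * cfP θ (n + 1) + cfP θ n

/-- The denominator `qₙ` of the `n`-th convergent of `θ`:
`q₀ = 1`, `q₁ = a₁`, `qₙ = aₙ·qₙ₋₁ + qₙ₋₂` (so `q₋₁ = 0`). -/
noncomputable def cfQ (θ : ℝ) : ℕ → ℤ
  | 0 => 1
  | 1 => cfA θ 1
  | n + 2 => cfA θ (n + 2) * cfQ θ (n + 1) + cfQ θ n

open Filter

/-- Consecutive denominators of convergents are coprime. -/
theorem isCoprime_cfQ_succ (θ : ℝ) (n : ℕ) : IsCoprime (cfQ θ n) (cfQ θ (n + 1)) := by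
  induction n with
  | zero => exact isCoprime_one_left
  | succ n ih =>
    rw [show cfQ θ (n + 1 + 1) = cfQ θ n + cfA θ (n + 2) * cfQ θ (n + 1) by
      rw [cfQ]; ring]
    exact IsCoprime.add_mul_right_right ih.symm _

/-- A divisor of `qₙ` divides `qₙ₊₂` if and only if it divides `aₙ₊₂`. -/
theorem dvd_cfQ_add_two_iff (θ : ℝ) {n : ℕ} {d : ℤ} (hd : d ∣ cfQ θ n) :
    d ∣ cfQ θ (n + 2) ↔ d ∣ cfA θ (n + 2) := by
  rw [cfQ, Int.dvd_add_left hd]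
  exact ⟨((isCoprime_cfQ_succ θ n).of_isCoprime_of_dvd_left hd).dvd_of_dvd_mul_right,
    fun h => h.mul_right _⟩

/-- Common divisors of `q₂ᵢ, q₂ᵢ₊₂, …, q₂ⱼ` are those of `q₂ᵢ, a₂ᵢ₊₂, …, a₂ⱼ`. -/
theorem forall_dvd_cfQ_iff (θ : ℝ) (d : ℤ) {i j : ℕ} (hij : i ≤ j) :
    (∀ k ∈ Finset.Icc i j, d ∣ cfQ θ (2 * k)) ↔
      d ∣ cfQ θ (2 * i) ∧ ∀ k ∈ Finset.Icc (i + 1) j, d ∣ cfA θ (2 * k) := by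
  simp only [Finset.mem_Icc]
  constructor
  · refine fun h => ⟨h i ⟨le_rfl, hij⟩, fun k hk => ?_⟩
    obtain ⟨m, rfl⟩ : ∃ m, k = m + 1 := ⟨k - 1, by omega⟩
    exact (dvd_cfQ_add_two_iff θ (h m (by omega))).1 (h (m + 1) (by omega))
  · rintro ⟨hi, ha⟩ k ⟨hik, hkj⟩
    induction k, hik using Nat.le_induction with
    | base => exact hi
    | succ m hm ih =>
      exact (dvd_cfQ_add_two_iff θ (ih (by omega))).2 (ha (m + 1) (by omega))

/-- `gcd(q₂ᵢ, q₂ᵢ₊₂, …, q₂ⱼ) = gcd(q₂ᵢ, a₂ᵢ₊₂, …, a₂ⱼ)`. -/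
theorem gcd_cfQ_eq (θ : ℝ) {i j : ℕ} (hij : i ≤ j) :
    Finset.gcd (Finset.Icc i j) (fun k => (cfQ θ (2 * k)).natAbs) =
      Nat.gcd (cfQ θ (2 * i)).natAbs
        (Finset.gcd (Finset.Icc (i + 1) j) (fun k => (cfA θ (2 * k)).natAbs)) := by
  refine Nat.dvd_left_iff_eq.1 fun d => ?_
  simp only [Nat.dvd_gcd_iff, Finset.dvd_gcd_iff, ← Int.natCast_dvd]
  exact forall_dvd_cfQ_iff θ d hij

/-- For every irrational `θ` and all `j > i ≥ 0`,
`gcd(q_{2i}, q_{2i+2}, …, q_{2j}) = gcd(q_{2i}, a_{2i+2}, a_{2i+4}, …, a_{2j})`.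
Consequently, for every `i ≥ 0`, the stable value of `j ↦ gcd(q_{2i}, …, q_{2j})` as `j → ∞`
equals the stable value of `j ↦ gcd(q_{2i}, a_{2i+2}, …, a_{2j})` as `j → ∞`. -/
theorem stmt_1 (θ : ℝ) (hθ : Irrational θ) :
    (∀ i j : ℕ, i < j →
      Finset.gcd (Finset.Icc i j) (fun k => (cfQ θ (2 * k)).natAbs) =
        Nat.gcd (cfQ θ (2 * i)).natAbs
          (Finset.gcd (Finset.Icc (i + 1) j) (fun k => (cfA θ (2 * k)).natAbs))) ∧
    (∀ i c : ℕ,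
      (∀ᶠ j in atTop, Finset.gcd (Finset.Icc i j) (fun k => (cfQ θ (2 * k)).natAbs) = c) ↔
      (∀ᶠ j in atTop,
        Nat.gcd (cfQ θ (2 * i)).natAbs
          (Finset.gcd (Finset.Icc (i + 1) j) (fun k => (cfA θ (2 * k)).natAbs)) = c)) := by
  refine ⟨fun i j hij => gcd_cfQ_eq θ hij.le, fun i c => eventually_congr ?_⟩
  filter_upwards [eventually_ge_atTop i] with j hij
  rw [gcd_cfQ_eq θ hij]
end

section
/- Let θ be an irrational real number and let r ∈ ℚ∞. Then there exists exactly one x ∈ ℚ∞ such that |x|_θ < |r|_θ and χ(|x|_θ, |r|_θ) = 1, and there exists exactly one y ∈ ℚ∞ such that |y|_θ < |r|_θ and χ(|y|_θ, |r|_θ) = −1; moreover these satisfy |x|_θ + |y|_θ = |r|_θ. -/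
/-- `p/q` is the standard form of an element of `ℚ∞ = ℚ ∪ {∞}`: either `q > 0` and
`gcd(p,q) = 1` (a rational number), or `(p,q) = (1,0)` (the point `∞ = 1/0`). -/
def StdForm (p q : ℤ) : Prop := (0 < q ∧ Int.gcd p q = 1) ∨ (p = 1 ∧ q = 0)

/-- For `r = p/q ∈ ℚ∞` in standard form, `|r|_θ = |qθ − p| ∈ ℝ`. -/
noncomputable def absTheta (θ : ℝ) (p q : ℤ) : ℝ := |(q : ℝ) * θ - (p : ℝ)|

/-- The coordinates `(m, n)` (with respect to the basis `(θ, 1)` of `L_θ = ℤθ + ℤ`) of the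
element `|p/q|_θ = |qθ − p|` of `L_θ`: it equals `mθ + n` where `(m,n) = (q,−p)` if
`qθ − p > 0`, and `(m,n) = (−q,p)` otherwise. -/
noncomputable def absCoords (θ : ℝ) (p q : ℤ) : ℤ × ℤ :=
  if 0 < (q : ℝ) * θ - (p : ℝ) then (q, -p) else (-q, p)

/-- The bilinear form `χ` on `L_θ = ℤθ + ℤ` in coordinates:
`χ(mθ + n, m′θ + n′) = m′·n − m·n′`. -/
def chiForm (v w : ℤ × ℤ) : ℤ := w.1 * v.2 - v.1 * w.2

/-- The real number `mθ + n` with coordinates `(m, n)`. -/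
noncomputable def coordsVal (θ : ℝ) (v : ℤ × ℤ) : ℝ := v.1 * θ + v.2

theorem coordsVal_ne_zero {θ : ℝ} (hθ : Irrational θ) {v : ℤ × ℤ} (hv : v ≠ 0) :
    coordsVal θ v ≠ 0 := by
  unfold coordsVal
  by_cases h : v.1 = 0
  · have h2 : v.2 ≠ 0 := fun h2 => hv (Prod.ext h h2)
    simpa [h] using h2
  · exact ((hθ.intCast_mul h).add_intCast v.2).ne_zero

theorem StdForm.isCoprime {p q : ℤ} (h : StdForm p q) : IsCoprime p q := by
  rcases h with ⟨_, h⟩ | ⟨rfl, rfl⟩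
  · exact Int.isCoprime_iff_gcd_eq_one.2 h
  · exact isCoprime_one_left

theorem coordsVal_absCoords (θ : ℝ) (p q : ℤ) :
    coordsVal θ (absCoords θ p q) = absTheta θ p q := by
  unfold coordsVal absCoords absTheta
  split_ifs with h
  · rw [abs_of_pos h]; push_cast; ring
  · rw [abs_of_nonpos (not_lt.1 h)]; push_cast; ring

theorem isCoprime_absCoords (θ : ℝ) {p q : ℤ} (h : IsCoprime p q) :
    IsCoprime (absCoords θ p q).1 (absCoords θ p q).2 := by
  unfold absCoords
  split_ifs
  · exact h.symm.neg_right
  · exact h.symm.neg_left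

theorem absTheta_pos {θ : ℝ} (hθ : Irrational θ) {p q : ℤ} (h : StdForm p q) :
    0 < absTheta θ p q := by
  refine lt_of_le_of_ne (abs_nonneg _) ?_
  rw [← coordsVal_absCoords]
  refine (coordsVal_ne_zero hθ fun h0 => ?_).symm
  have := isCoprime_absCoords θ h.isCoprime
  rw [h0] at this
  exact not_isCoprime_zero_zero this

theorem absCoords_injOn {θ : ℝ} {p q p' q' : ℤ} (h : StdForm p q) (h' : StdForm p' q')
    (he : absCoords θ p q = absCoords θ p' q') : p = p' ∧ q = q' := by
  unfold absCoords at he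
  unfold StdForm at h h'
  split_ifs at he <;> simp only [Prod.mk.injEq] at he <;> omega

theorem exists_absCoords_eq {θ : ℝ} {v : ℤ × ℤ} (hc : IsCoprime v.1 v.2)
    (hv : 0 < coordsVal θ v) : ∃ p q : ℤ, StdForm p q ∧ absCoords θ p q = v := by
  obtain ⟨m, n⟩ := v
  simp only [coordsVal] at hc hv
  have pos : 0 < (m : ℝ) * θ - ((-n : ℤ) : ℝ) := by push_cast; linarith
  have neg : ¬ 0 < ((-m : ℤ) : ℝ) * θ - (n : ℝ) := by push_cast; linarith
  rcases lt_trichotomy m 0 with hm | rfl | hm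
  · refine ⟨n, -m, Or.inl ⟨by omega, Int.isCoprime_iff_gcd_eq_one.1 hc.symm.neg_right⟩, ?_⟩
    simp only [absCoords, if_neg neg, neg_neg]
  · have hn : 0 < n := by
      have : (0 : ℝ) < n := by simpa using hv
      exact_mod_cast this
    obtain rfl : n = 1 := by
      rcases Int.isUnit_iff.1 (isCoprime_zero_left.1 hc) with h | h <;> omega
    exact ⟨1, 0, Or.inr ⟨rfl, rfl⟩, by simp [absCoords]⟩
  · refine ⟨-n, m, Or.inl ⟨hm, Int.isCoprime_iff_gcd_eq_one.1 hc.symm.neg_left⟩, ?_⟩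
    simp only [absCoords, if_pos pos, neg_neg]

theorem exists_eq_smul_of_chiForm_eq_zero {v w : ℤ × ℤ} (hw : IsCoprime w.1 w.2)
    (h : chiForm v w = 0) : ∃ k : ℤ, v = k • w := by
  obtain ⟨a, b, hab⟩ := hw
  unfold chiForm at h
  refine ⟨a * v.1 + b * v.2, Prod.ext ?_ ?_⟩ <;>
    simp only [Prod.smul_fst, Prod.smul_snd, smul_eq_mul]
  · linear_combination (-v.1) * hab - b * h
  · linear_combination (-v.2) * hab + a * h

theorem coordsVal_add (θ : ℝ) (v w : ℤ × ℤ) :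
    coordsVal θ (v + w) = coordsVal θ v + coordsVal θ w := by
  simp only [coordsVal, Prod.fst_add, Prod.snd_add]; push_cast; ring

theorem coordsVal_smul (θ : ℝ) (k : ℤ) (w : ℤ × ℤ) :
    coordsVal θ (k • w) = k * coordsVal θ w := by
  simp only [coordsVal, Prod.smul_fst, Prod.smul_snd, smul_eq_mul]; push_cast; ring

theorem chiForm_add_smul_self (v w : ℤ × ℤ) (k : ℤ) : chiForm (v + k • w) w = chiForm v w := by
  simp only [chiForm, Prod.fst_add, Prod.snd_add, Prod.smul_fst, Prod.smul_snd, smul_eq_mul]; ring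

theorem exists_chiForm_eq {θ : ℝ} (hθ : Irrational θ) {w : ℤ × ℤ} (hw : IsCoprime w.1 w.2)
    (hpos : 0 < coordsVal θ w) {ε : ℤ} (hε : ε ≠ 0) :
    ∃ v : ℤ × ℤ, 0 < coordsVal θ v ∧ coordsVal θ v < coordsVal θ w ∧ chiForm v w = ε := by
  obtain ⟨a, b, hab⟩ := hw
  set u : ℤ × ℤ := (-(ε * b), ε * a)
  have hu : chiForm u w = ε := by
    simp only [chiForm, u]; linear_combination ε * hab
  set k := ⌊coordsVal θ u / coordsVal θ w⌋
  have hv : chiForm (u + (-k) • w) w = ε := by rw [chiForm_add_smul_self, hu]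
  have hne : coordsVal θ (u + (-k) • w) ≠ 0 := by
    refine coordsVal_ne_zero hθ fun h0 => hε ?_
    rw [← hv, h0]; simp [chiForm]
  have hval : coordsVal θ (u + (-k) • w) = coordsVal θ u - k * coordsVal θ w := by
    rw [coordsVal_add, coordsVal_smul]; push_cast; ring
  have h1 : k * coordsVal θ w ≤ coordsVal θ u := (le_div_iff₀ hpos).1 (Int.floor_le _)
  have h2 : coordsVal θ u < (k + 1) * coordsVal θ w :=
    (div_lt_iff₀ hpos).1 (Int.lt_floor_add_one _)
  exact ⟨_, lt_of_le_of_ne (by linarith) hne.symm, by linarith, hv⟩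

theorem eq_of_chiForm_eq {θ : ℝ} {v v' w : ℤ × ℤ} (hw : IsCoprime w.1 w.2)
    (hv : 0 < coordsVal θ v) (hvw : coordsVal θ v < coordsVal θ w)
    (hv' : 0 < coordsVal θ v') (hvw' : coordsVal θ v' < coordsVal θ w)
    (h : chiForm v w = chiForm v' w) : v = v' := by
  obtain ⟨k, hk⟩ := exists_eq_smul_of_chiForm_eq_zero (v := v - v') hw (by
    simp only [chiForm, Prod.fst_sub, Prod.snd_sub] at h ⊢; linear_combination h)
  have hvk : v = v' + k • w := by rw [← hk]; abel
  have hval : coordsVal θ v = coordsVal θ v' + k * coordsVal θ w := by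
    rw [← coordsVal_smul, ← coordsVal_add, ← hvk]
  have hk1 : (k : ℝ) < 1 := by nlinarith
  have hk2 : (-1 : ℝ) < k := by nlinarith
  have hk1' : k < 1 := by exact_mod_cast hk1
  have hk2' : -1 < k := by exact_mod_cast hk2
  obtain rfl : k = 0 := by omega
  simpa using hvk

theorem coordsVal_add_eq {θ : ℝ} {v v' w : ℤ × ℤ} (hw : IsCoprime w.1 w.2)
    (hv : 0 < coordsVal θ v) (hvw : coordsVal θ v < coordsVal θ w)
    (hv' : 0 < coordsVal θ v') (hvw' : coordsVal θ v' < coordsVal θ w)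
    (h : chiForm v w + chiForm v' w = 0) :
    coordsVal θ v + coordsVal θ v' = coordsVal θ w := by
  obtain ⟨k, hk⟩ := exists_eq_smul_of_chiForm_eq_zero (v := v + v') hw (by
    simp only [chiForm, Prod.fst_add, Prod.snd_add] at h ⊢; linear_combination h)
  have hval : coordsVal θ v + coordsVal θ v' = k * coordsVal θ w := by
    rw [← coordsVal_smul, ← coordsVal_add, hk]
  have hk1 : (k : ℝ) < 2 := by nlinarith
  have hk2 : (0 : ℝ) < k := by nlinarith
  have hk1' : k < 2 := by exact_mod_cast hk1
  have hk2' : 0 < k := by exact_mod_cast hk2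
  obtain rfl : k = 1 := by omega
  simpa using hval

theorem isCoprime_of_isUnit_chiForm {v w : ℤ × ℤ} (h : IsUnit (chiForm v w)) :
    IsCoprime v.1 v.2 := by
  obtain ⟨c, hc⟩ := h.exists_left_inv
  unfold chiForm at hc
  exact ⟨-(c * w.2), c * w.1, by linear_combination hc⟩

theorem existsUnique_chiForm_absCoords_eq {θ : ℝ} (hθ : Irrational θ) {p q : ℤ}
    (hr : StdForm p q) {ε : ℤ} (hε : IsUnit ε) :
    ∃! x : ℤ × ℤ, StdForm x.1 x.2 ∧ absTheta θ x.1 x.2 < absTheta θ p q ∧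
      chiForm (absCoords θ x.1 x.2) (absCoords θ p q) = ε := by
  have hw := isCoprime_absCoords θ hr.isCoprime
  obtain ⟨v, hv, hvw, hχ⟩ := exists_chiForm_eq hθ hw
    (by rw [coordsVal_absCoords]; exact absTheta_pos hθ hr) hε.ne_zero
  obtain ⟨a, b, hab, rfl⟩ := exists_absCoords_eq (isCoprime_of_isUnit_chiForm (hχ ▸ hε)) hv
  simp only [coordsVal_absCoords] at hvw
  refine ⟨(a, b), ⟨hab, hvw, hχ⟩, fun y ⟨hy, hyw, hyχ⟩ => ?_⟩
  have he : absCoords θ y.1 y.2 = absCoords θ a b := by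
    refine eq_of_chiForm_eq (θ := θ) hw ?_ ?_ ?_ ?_ (hyχ.trans hχ.symm) <;>
      simp only [coordsVal_absCoords]
    exacts [absTheta_pos hθ hy, hyw, absTheta_pos hθ hab, hvw]
  obtain ⟨h1, h2⟩ := absCoords_injOn hy hab he
  exact Prod.ext h1 h2

/-- Let `θ` be irrational and `r = p/q ∈ ℚ∞`. There is exactly one `x ∈ ℚ∞`
with `|x|_θ < |r|_θ` and `χ(|x|_θ, |r|_θ) = 1`, and exactly one `y ∈ ℚ∞` with
`|y|_θ < |r|_θ` and `χ(|y|_θ, |r|_θ) = −1`; moreover these satisfy `|x|_θ + |y|_θ = |r|_θ`. -/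
theorem stmt_5 (θ : ℝ) (hθ : Irrational θ) (p q : ℤ) (hr : StdForm p q) :
    (∃! x : ℤ × ℤ, StdForm x.1 x.2 ∧ absTheta θ x.1 x.2 < absTheta θ p q ∧
      chiForm (absCoords θ x.1 x.2) (absCoords θ p q) = 1) ∧
    (∃! y : ℤ × ℤ, StdForm y.1 y.2 ∧ absTheta θ y.1 y.2 < absTheta θ p q ∧
      chiForm (absCoords θ y.1 y.2) (absCoords θ p q) = -1) ∧
    (∀ x y : ℤ × ℤ,
      StdForm x.1 x.2 → absTheta θ x.1 x.2 < absTheta θ p q →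
        chiForm (absCoords θ x.1 x.2) (absCoords θ p q) = 1 →
      StdForm y.1 y.2 → absTheta θ y.1 y.2 < absTheta θ p q →
        chiForm (absCoords θ y.1 y.2) (absCoords θ p q) = -1 →
      absTheta θ x.1 x.2 + absTheta θ y.1 y.2 = absTheta θ p q) := by
  refine ⟨existsUnique_chiForm_absCoords_eq hθ hr isUnit_one,
    existsUnique_chiForm_absCoords_eq hθ hr isUnit_one.neg, fun x y hx hxr hxχ hy hyr hyχ => ?_⟩
  have key := coordsVal_add_eq (θ := θ) (v := absCoords θ x.1 x.2) (v' := absCoords θ y.1 y.2)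
    (isCoprime_absCoords θ hr.isCoprime)
  simp only [coordsVal_absCoords] at key
  exact key (absTheta_pos hθ hx) hxr (absTheta_pos hθ hy) hyr (by rw [hxχ, hyχ]; rfl)
end

section
/- Let θ < θ′ be irrational real numbers. Then there exists a unique Farey triangle whose vertices r < s < t (elements of ℚ∞) satisfy r < θ < s < θ′ < t. Equivalently, there exists a unique quadruple of integers (a, b, e, f) with b ≥ 1, f ≥ 0, gcd(a,b) = 1, gcd(e,f) = 1, e·b − a·f = 1, and a < bθ, (b+f)θ < a+e, a+e < (b+f)θ′, fθ′ < e (so that r = a/b, s = (a+e)/(b+f) and t = e/f, with t = ∞ when f = 0). -/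
/-- `(a, b, e, f)` encodes the Farey triangle with vertices `r = a/b < s = (a+e)/(b+f) < t = e/f`
(with `t = ∞` when `f = 0`) separating the irrationals `θ < θ′`: the vertices are in standard
form, `r` and `t` are Farey-adjacent (`e·b − a·f = 1`, so `s` is their mediant), and
`r < θ < s < θ′ < t`. -/
def CanonFareyTriangle (θ θ' : ℝ) (a b e f : ℤ) : Prop :=
  1 ≤ b ∧ 0 ≤ f ∧ Int.gcd a b = 1 ∧ Int.gcd e f = 1 ∧ e * b - a * f = 1 ∧
  (a : ℝ) < (b : ℝ) * θ ∧ ((b : ℝ) + (f : ℝ)) * θ < (a : ℝ) + (e : ℝ) ∧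
  (a : ℝ) + (e : ℝ) < ((b : ℝ) + (f : ℝ)) * θ' ∧ (f : ℝ) * θ' < (e : ℝ)

/-- A fraction `p / q` lying strictly between Farey neighbours `a / b` and `e / f` has denominator
at least `b + f`. -/
theorem farey_denom_le {a b e f p q : ℤ} (hb : 1 ≤ b) (hf : 0 ≤ f) (h : e * b - a * f = 1)
    (h₁ : 0 < p * b - a * q) (h₂ : 0 < e * q - p * f) : b + f ≤ q := by
  have key : q = b * (e * q - p * f) + f * (p * b - a * q) := by linear_combination (-q) * h
  nlinarith

/-- If the fraction `p / q` strictly between Farey neighbours `a / b` and `e / f` with `f ≠ 0` has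
denominator `b + f`, it is their mediant. -/
theorem farey_num_eq {a b e f p q : ℤ} (hb : 1 ≤ b) (hf : 1 ≤ f) (h : e * b - a * f = 1)
    (h₁ : 0 < p * b - a * q) (h₂ : 0 < e * q - p * f) (hq : q = b + f) : p = a + e := by
  have key : q = b * (e * q - p * f) + f * (p * b - a * q) := by linear_combination (-q) * h
  have h₃ : p * b - a * q = 1 := by nlinarith
  have h₄ : e * q - p * f = 1 := by nlinarith
  linear_combination (-p) * h + e * h₃ + a * h₄

/-- The left parent of a fraction `p / q` is unique. -/
theorem farey_left_parent_unique {p q a b a' b' : ℤ} (hb : 1 ≤ b) (hbq : b < q) (hb' : 1 ≤ b')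
    (hbq' : b' < q) (h : p * b - a * q = 1) (h' : p * b' - a' * q = 1) : a = a' ∧ b = b' := by
  have hd : q ∣ b' - b :=
    ⟨b * (a' - a) - a * (b' - b), by linear_combination (b - b') * h + b * (h' - h)⟩
  have h0 : b' - b = 0 := Int.eq_zero_of_abs_lt_dvd hd (abs_lt.2 ⟨by linarith, by linarith⟩)
  have hbb : b' = b := by linarith
  subst hbb
  exact ⟨mul_right_cancel₀ (show q ≠ 0 by linarith) (by linarith), rfl⟩

namespace CanonFareyTriangle

variable {θ θ' : ℝ} {a b e f a' b' e' f' : ℤ}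

theorem mediant_between (h : CanonFareyTriangle θ θ' a b e f)
    (h' : CanonFareyTriangle θ θ' a' b' e' f') :
    0 < (a + e) * b' - a' * (b + f) ∧ 0 < e' * (b + f) - (a + e) * f' := by
  obtain ⟨hb, hf, -, -, -, -, h₂, h₃, -⟩ := h
  obtain ⟨hb', hf', -, -, -, k₁, -, -, k₄⟩ := h'
  have hs : (0 : ℝ) < b + f := by exact_mod_cast (by linarith : 0 < b + f)
  have hbr : (0 : ℝ) < b' := by exact_mod_cast (by linarith : 0 < b')
  have hfr : (0 : ℝ) ≤ f' := by exact_mod_cast hf'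
  constructor
  · have : (0 : ℝ) < (a + e) * b' - a' * (b + f) := by nlinarith
    exact_mod_cast this
  · have : (0 : ℝ) < e' * (b + f) - (a + e) * f' := by nlinarith
    exact_mod_cast this

theorem unique (h : CanonFareyTriangle θ θ' a b e f)
    (h' : CanonFareyTriangle θ θ' a' b' e' f') : a = a' ∧ b = b' ∧ e = e' ∧ f = f' := by
  obtain ⟨m₁, m₂⟩ := mediant_between h h'
  obtain ⟨m₁', m₂'⟩ := mediant_between h' h
  obtain ⟨hb, hf, -, -, hd, h₁, h₂, -, -⟩ := h
  obtain ⟨hb', hf', -, -, hd', k₁, k₂, -, -⟩ := h'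
  have hq : b + f = b' + f' :=
    le_antisymm (farey_denom_le hb hf hd m₁' m₂') (farey_denom_le hb' hf' hd' m₁ m₂)
  by_cases hf1 : 1 ≤ f ∧ 1 ≤ f'
  · have hp := farey_num_eq hb' hf1.2 hd' m₁ m₂ hq
    have := farey_left_parent_unique (p := a + e) (q := b + f) hb (by linarith) hb'
      (by linarith) (by linear_combination hd)
      (a' := a') (by rw [hp, hq]; linear_combination hd')
    grind
  · have hbf : b = 1 ∧ f = 0 ∧ b' = 1 ∧ f' = 0 := by
      rcases hf.eq_or_lt with rfl | hf0
      · have : b = 1 := Int.eq_one_of_dvd_one (by linarith) ⟨e, by linarith⟩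
        omega
      · have : f' = 0 := by omega
        subst this
        have : b' = 1 := Int.eq_one_of_dvd_one (by linarith) ⟨e', by linarith⟩
        omega
    obtain ⟨rfl, rfl, rfl, rfl⟩ := hbf
    obtain rfl : e = 1 := by linarith
    obtain rfl : e' = 1 := by linarith
    have : a = a' := by omega
    exact ⟨this, rfl, rfl, rfl⟩

theorem of_det (hb : 1 ≤ b) (hf : 0 ≤ f) (hd : e * b - a * f = 1) (h₁ : (a : ℝ) < b * θ)
    (h₂ : ((b : ℝ) + f) * θ < a + e) (h₃ : (a : ℝ) + e < (b + f) * θ') (h₄ : f * θ' < (e : ℝ)) :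
    CanonFareyTriangle θ θ' a b e f :=
  ⟨hb, hf, Int.isCoprime_iff_gcd_eq_one.1 ⟨-f, e, by linear_combination hd⟩,
    Int.isCoprime_iff_gcd_eq_one.1 ⟨b, -a, by linear_combination hd⟩, hd, h₁, h₂, h₃, h₄⟩

end CanonFareyTriangle

/-- A positive integer `q` is the denominator of a fraction in `(θ, θ')`. -/
def IsDenomBetween (θ θ' : ℝ) (q : ℕ) : Prop :=
  0 < q ∧ ∃ p : ℤ, (q : ℝ) * θ < p ∧ (p : ℝ) < q * θ'

theorem exists_isDenomBetween {θ θ' : ℝ} (hlt : θ < θ') : ∃ q, IsDenomBetween θ θ' q := by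
  obtain ⟨x, h₁, h₂⟩ := exists_rat_btwn hlt
  have hx : (x : ℝ) * x.den = x.num := by exact_mod_cast Rat.mul_den_eq_num x
  have hd : (0 : ℝ) < x.den := by exact_mod_cast x.pos
  exact ⟨x.den, x.pos, x.num, by nlinarith, by nlinarith⟩

/-- A fraction whose denominator is minimal among the fractions in `(θ, θ')` is reduced. -/
theorem isCoprime_of_minimal {θ θ' : ℝ} {q : ℕ} {p : ℤ} (hq : 0 < q) (h₁ : (q : ℝ) * θ < p)
    (h₂ : (p : ℝ) < q * θ') (hmin : ∀ m, IsDenomBetween θ θ' m → q ≤ m) :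
    IsCoprime p (q : ℤ) := by
  rw [Int.isCoprime_iff_gcd_eq_one]
  set g := Int.gcd p q with hg
  have hg0 : 0 < g := Int.gcd_pos_of_ne_zero_right _ (by exact_mod_cast hq.ne')
  obtain ⟨p', hp'⟩ : (g : ℤ) ∣ p := Int.gcd_dvd_left ..
  obtain ⟨q', hq'⟩ : g ∣ q := by exact_mod_cast (Int.gcd_dvd_right p q)
  have hgr : (0 : ℝ) < g := by exact_mod_cast hg0
  have hpr : (p : ℝ) = g * p' := by exact_mod_cast hp'
  have hqr : (q : ℝ) = g * q' := by exact_mod_cast hq'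
  rw [hpr, hqr, mul_assoc] at h₁ h₂
  have hq0 : 0 < q' := Nat.pos_of_ne_zero (by rintro rfl; simp at hq'; omega)
  have := hmin q' ⟨hq0, p', lt_of_mul_lt_mul_left h₁ hgr.le, lt_of_mul_lt_mul_left h₂ hgr.le⟩
  nlinarith

theorem exists_canonFareyTriangle {θ θ' : ℝ} (hθ : Irrational θ) (hθ' : Irrational θ')
    (hlt : θ < θ') : ∃ a b e f, CanonFareyTriangle θ θ' a b e f := by
  classical
  have hex := exists_isDenomBetween hlt
  obtain ⟨hq, p, h₁, h₂⟩ := Nat.find_spec hex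
  have hmin : ∀ m, IsDenomBetween θ θ' m → Nat.find hex ≤ m := fun m => Nat.find_min' hex
  generalize Nat.find hex = q at hq h₁ h₂ hmin
  rcases (Nat.succ_le_of_lt hq).eq_or_lt with hq1 | hq1
  · obtain rfl : q = 1 := hq1.symm
    simp only [Nat.cast_one, one_mul] at h₁ h₂
    have hfl : (⌊θ⌋ : ℝ) < θ := (Int.floor_le θ).lt_of_ne (hθ.ne_int _).symm
    have hp : (⌊θ⌋ : ℝ) + 1 ≤ p := by exact_mod_cast Int.floor_lt.2 h₁
    exact ⟨⌊θ⌋, 1, 1, 0, .of_det le_rfl le_rfl (by ring) (by simpa using hfl)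
      (by simp) (by push_cast; linarith) (by simp)⟩
  obtain ⟨u, v, huv⟩ := isCoprime_of_minimal hq h₁ h₂ hmin
  have hq0 : (0 : ℤ) < q := by exact_mod_cast hq
  have hqr : (0 : ℝ) < q := by exact_mod_cast hq
  obtain ⟨a, b, hb0, hbq, hd⟩ : ∃ a b : ℤ, 0 ≤ b ∧ b < q ∧ p * b - a * q = 1 :=
    ⟨-(v + p * (u / q)), u % q, Int.emod_nonneg _ hq0.ne', Int.emod_lt_of_pos _ hq0, by
      linear_combination huv + p * Int.emod_add_mul_ediv u q⟩
  have hb : 0 < b := by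
    refine hb0.lt_of_ne ?_
    rintro rfl
    have : (q : ℤ) = 1 := Int.eq_one_of_dvd_one hq0.le ⟨-a, by linarith⟩
    omega
  have hdr : (p : ℝ) * b - a * q = 1 := by exact_mod_cast hd
  have hbr : (0 : ℝ) < b := by exact_mod_cast hb
  have hbqr : (b : ℝ) < q := by exact_mod_cast hbq
  have hno : ∀ m n : ℤ, 0 < n → n < q → (n : ℝ) * θ < m → ¬ (m : ℝ) < n * θ' := by
    intro m n hn hnq k₁ k₂
    lift n to ℕ using hn.le
    have := hmin n ⟨by exact_mod_cast hn, m, by exact_mod_cast k₁, by exact_mod_cast k₂⟩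
    omega
  have ha : (a : ℝ) < b * θ := by
    refine (lt_or_gt_of_ne ((hθ.intCast_mul hb.ne').ne_int a).symm).resolve_right fun h => ?_
    refine hno a b hb hbq h ?_
    have : (a : ℝ) * q < b * θ' * q := by nlinarith
    exact lt_of_mul_lt_mul_right this hqr.le
  have he : ((q - b : ℤ) : ℝ) * θ' < (p - a : ℤ) := by
    have hf : 0 < (q : ℤ) - b := by linarith
    refine (lt_or_gt_of_ne ((hθ'.intCast_mul hf.ne').ne_int (p - a))).resolve_right fun h => ?_
    refine hno _ _ hf (by linarith) ?_ h
    have : ((q - b : ℤ) : ℝ) * θ * q < (p - a : ℤ) * q := by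
      push_cast
      nlinarith
    exact lt_of_mul_lt_mul_right this hqr.le
  exact ⟨a, b, p - a, q - b, .of_det hb (by linarith) (by linear_combination hd) ha
    (by push_cast; linarith) (by push_cast; linarith) he⟩

/-- Let `θ < θ′` be irrational real numbers. Then there is a unique Farey
triangle whose vertices `r < s < t` (elements of `ℚ∞`) satisfy `r < θ < s < θ′ < t`;
equivalently, a unique quadruple of integers `(a, b, e, f)` with `b ≥ 1`, `f ≥ 0`,
`gcd(a,b) = 1`, `gcd(e,f) = 1`, `e·b − a·f = 1`, and `a < bθ`, `(b+f)θ < a+e`,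
`a+e < (b+f)θ′`, `fθ′ < e`. -/
theorem stmt_6 (θ θ' : ℝ) (hθ : Irrational θ) (hθ' : Irrational θ') (hlt : θ < θ') :
    ∃! v : ℤ × ℤ × ℤ × ℤ, CanonFareyTriangle θ θ' v.1 v.2.1 v.2.2.1 v.2.2.2 := by
  obtain ⟨a, b, e, f, h⟩ := exists_canonFareyTriangle hθ hθ' hlt
  refine ⟨(a, b, e, f), h, ?_⟩
  rintro ⟨a', b', e', f'⟩ h'
  obtain ⟨rfl, rfl, rfl, rfl⟩ := CanonFareyTriangle.unique h h'
  rfl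
end

section
/- Let θ < θ′ be irrational real numbers, and let (a, b, e, f) be the unique integers with b ≥ 1, f ≥ 0, gcd(a,b) = 1, gcd(e,f) = 1, e·b − a·f = 1, a < bθ, (b+f)θ < a+e, a+e < (b+f)θ′ and fθ′ < e (the canonical Farey triangle separating θ and θ′). Then for every rational number p/q in lowest terms with q ≥ 1 and θ < p/q < θ′, one has q ≥ b + f; and if q = b + f, then p ≥ a + e. In other words, the middle vertex s = (a+e)/(b+f) of the canonical Farey triangle is the rational number strictly between θ and θ′ of smallest denominator, and among rationals in (θ, θ′) with this denominator it is the smallest. -/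
/-- Let `θ < θ′` be irrational, and let `(a, b, e, f)` be the canonical Farey
triangle separating `θ` and `θ′`. Then every rational `p/q` in lowest terms with `q ≥ 1` and
`θ < p/q < θ′` satisfies `q ≥ b + f`, and if `q = b + f` then `p ≥ a + e`: the middle vertex
`s = (a+e)/(b+f)` is the rational strictly between `θ` and `θ′` of smallest denominator, and
among those with this denominator it is the smallest. -/
theorem stmt_7 (θ θ' : ℝ) (hθ : Irrational θ) (hθ' : Irrational θ') (hlt : θ < θ')
    (a b e f : ℤ) (h : CanonFareyTriangle θ θ' a b e f)
    (p q : ℤ) (hq : 1 ≤ q) (hpq : Int.gcd p q = 1)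
    (h1 : θ < (p : ℝ) / (q : ℝ)) (h2 : (p : ℝ) / (q : ℝ) < θ') :
    b + f ≤ q ∧ (q = b + f → a + e ≤ p) := by
  obtain ⟨hb, hf, -, -, hdet, har, -, -, hte⟩ := h
  have hq' : (0 : ℝ) < q := by exact_mod_cast (by omega : 0 < q)
  have hb' : (0 : ℝ) < b := by exact_mod_cast (by omega : 0 < b)
  have hf' : (0 : ℝ) ≤ f := by exact_mod_cast hf
  rw [lt_div_iff₀ hq'] at h1
  rw [div_lt_iff₀ hq'] at h2
  have hu : a * q < b * p := by
    have : (a : ℝ) * q < b * p := by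
      nlinarith [mul_lt_mul_of_pos_right har hq', mul_lt_mul_of_pos_left h1 hb']
    exact_mod_cast this
  have hv : f * p < e * q := by
    have : (f : ℝ) * p < e * q := by
      nlinarith [mul_lt_mul_of_pos_right hte hq', mul_le_mul_of_nonneg_left h2.le hf']
    exact_mod_cast this
  -- coordinates of `(p, q)` in the basis `(e, f), (a, b)` of `ℤ²`
  obtain ⟨u, hu_def⟩ : ∃ u, u = b * p - a * q := ⟨_, rfl⟩
  obtain ⟨v, hv_def⟩ : ∃ v, v = e * q - f * p := ⟨_, rfl⟩
  have hu1 : 1 ≤ u := by omega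
  have hv1 : 1 ≤ v := by omega
  have hqe : q = b * v + f * u := by
    rw [hu_def, hv_def]; linear_combination -q * hdet
  have hpe : p = a * v + e * u := by
    rw [hu_def, hv_def]; linear_combination -p * hdet
  have hbv : b ≤ b * v := le_mul_of_one_le_right (by omega) hv1
  have hfu : f ≤ f * u := le_mul_of_one_le_right hf hu1
  refine ⟨by omega, fun hqs => ?_⟩
  have hv_eq : v = 1 := by
    have : b * v = b * 1 := by omega
    exact mul_left_cancel₀ (by omega) this
  subst hv_eq
  have heu : e ≤ e * u := by
    rcases hf.eq_or_lt with rfl | hf_pos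
    · have he : 0 < e := pos_of_mul_pos_left (by linarith : 0 < e * b) (by omega)
      exact le_mul_of_one_le_right he.le hu1
    · have : f * u = f * 1 := by omega
      rw [mul_left_cancel₀ hf_pos.ne' this, mul_one]
  linarith
end

section
/- The set of irrational real numbers θ for which the sequence (cᵢ(θ))_{i≥0} is unbounded — equivalently, c(θ) = ∞; equivalently, for every integer M there exist an index i and an integer d > M such that d divides q_{2j}(θ) for all j ≥ i — is infinite. -/
/-- A truncated system of complete quotients: the relations `xₙ = aₙ + 1 / xₙ₊₁` can be solved
for all `n < N` with `xₙ ∈ [aₙ, aₙ + 1]`. -/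
lemma exists_truncated_complete_quotients (N : ℕ) (a : ℕ → ℤ) (ha : ∀ n, 1 ≤ a n) :
    ∃ x : ℕ → ℝ, (∀ n, x n ∈ Set.Icc (a n : ℝ) (a n + 1)) ∧
      ∀ n < N, x n * x (n + 1) = a n * x (n + 1) + 1 := by
  induction N generalizing a with
  | zero => exact ⟨fun n => a n, fun n => by simp, by simp⟩
  | succ N ih =>
    obtain ⟨y, hy, hrel⟩ := ih (fun n => a (n + 1)) fun n => ha (n + 1)
    have hy1 : 1 ≤ y 0 := by
      have h1 : (1 : ℝ) ≤ a 1 := by exact_mod_cast ha 1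
      exact h1.trans (hy 0).1
    have hinv : 0 < (y 0)⁻¹ := by positivity
    have hinv1 : (y 0)⁻¹ ≤ 1 := inv_le_one_of_one_le₀ hy1
    refine ⟨fun n => Nat.casesOn n (a 0 + (y 0)⁻¹) y, ?_, ?_⟩
    · rintro (_ | n)
      · exact ⟨by simpa using hinv.le, by simpa using hinv1⟩
      · exact hy n
    · rintro (_ | n) hn
      · have : y 0 ≠ 0 := by positivity
        change (a 0 + (y 0)⁻¹) * y 0 = a 0 * y 0 + 1
        field_simp
      · exact hrel n (by omega)

/-- Every sequence of positive integers admits a full system of complete quotients. -/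
lemma exists_complete_quotients (a : ℕ → ℤ) (ha : ∀ n, 1 ≤ a n) :
    ∃ x : ℕ → ℝ, (∀ n, x n ∈ Set.Icc (a n : ℝ) (a n + 1)) ∧
      ∀ n, x n * x (n + 1) = a n * x (n + 1) + 1 := by
  let K : Set (ℕ → ℝ) := Set.univ.pi fun n => Set.Icc (a n : ℝ) (a n + 1)
  let S : ℕ → Set (ℕ → ℝ) := fun N =>
    K ∩ {x | ∀ n < N, x n * x (n + 1) = a n * x (n + 1) + 1}
  have hK : IsCompact K := isCompact_univ_pi fun n => isCompact_Icc
  have hclosed : ∀ N, IsClosed {x : ℕ → ℝ | ∀ n < N, x n * x (n + 1) = a n * x (n + 1) + 1} := by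
    intro N
    simp only [Set.ofPred_forall]
    exact isClosed_iInter fun n => isClosed_iInter fun _ =>
      isClosed_eq (by fun_prop) (by fun_prop)
  have hS : (⋂ N, S N).Nonempty := by
    refine IsCompact.nonempty_iInter_of_sequence_nonempty_isCompact_isClosed S ?_ ?_ ?_ ?_
    · exact fun N x hx => ⟨hx.1, fun n hn => hx.2 n (by omega)⟩
    · intro N
      obtain ⟨x, hx, hrel⟩ := exists_truncated_complete_quotients N a ha
      exact ⟨x, fun n _ => hx n, hrel⟩
    · exact hK.inter_right (hclosed 0)
    · exact fun N => hK.isClosed.inter (hclosed N)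
  obtain ⟨x, hx⟩ := hS
  rw [Set.mem_iInter] at hx
  exact ⟨x, fun n => (hx 0).1 n trivial, fun n => (hx (n + 1)).2 n (by omega)⟩

/-- Every sequence of positive integers is the sequence of partial quotients of an irrational. -/
lemma exists_irrational_cfA_eq (a : ℕ → ℤ) (ha : ∀ n, 1 ≤ a n) :
    ∃ θ : ℝ, Irrational θ ∧ ∀ n, cfA θ n = a n := by
  obtain ⟨x, hx, hrel⟩ := exists_complete_quotients a ha
  have ha' : ∀ n, (1 : ℝ) ≤ a n := fun n => by exact_mod_cast ha n
  have hpos : ∀ n, 0 < x n := fun n => by linarith [ha' n, (hx n).1]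
  have hrec : ∀ n, x n = a n + (x (n + 1))⁻¹ := fun n => by
    have := (hpos (n + 1)).ne'
    field_simp
    linarith [hrel n]
  have hgt : ∀ n, 1 < x n := fun n => by
    have := inv_pos.2 (hpos (n + 1))
    linarith [hrec n, ha' n]
  have hfloor : ∀ n, ⌊x n⌋ = a n := fun n => by
    rw [Int.floor_eq_iff]
    refine ⟨(hx n).1, ?_⟩
    linarith [hrec n, inv_lt_one_of_one_lt₀ (hgt (n + 1))]
  have haux : ∀ n, cfAux (x 0) n = x n := by
    intro n
    induction n with
    | zero => rfl
    | succ n ih =>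
      rw [cfAux, ih, Int.fract, hfloor, hrec n, add_sub_cancel_left, inv_inv]
  have hdescent : ∀ d n : ℕ, 0 < d → ∀ p : ℤ, x n * d ≠ p := by
    intro d
    induction d using Nat.strong_induction_on with
    | _ d ih =>
      intro n hd p hp
      have hd' : (0 : ℝ) < d := by exact_mod_cast hd
      have hr : ((p - a n * d : ℤ) : ℝ) = (x (n + 1))⁻¹ * d := by
        push_cast
        rw [← hp, hrec n]
        ring
      have hr0 : 0 < p - a n * d := by
        have : (0 : ℝ) < ((p - a n * d : ℤ) : ℝ) := by
          rw [hr]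
          exact mul_pos (inv_pos.2 (hpos _)) hd'
        exact_mod_cast this
      have hrd : p - a n * d < d := by
        have : ((p - a n * d : ℤ) : ℝ) < ((d : ℤ) : ℝ) := by
          rw [hr, Int.cast_natCast]
          exact mul_lt_of_lt_one_left hd' (inv_lt_one_of_one_lt₀ (hgt _))
        exact_mod_cast this
      obtain ⟨r, hreq⟩ := Int.eq_ofNat_of_zero_le hr0.le
      rw [hreq] at hr hr0 hrd
      refine ih r (by omega) (n + 1) (by omega) d ?_
      rw [Int.cast_natCast] at hr
      rw [hr, Int.cast_natCast, mul_inv_cancel_left₀ (hpos (n + 1)).ne']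
  refine ⟨x 0, ?_, fun n => by rw [cfA, haux, hfloor]⟩
  rintro ⟨q, hq⟩
  refine hdescent q.den 0 q.pos q.num ?_
  rw [← hq]
  exact_mod_cast q.mul_den_eq_num

lemma cfAux_add_natCast_succ (θ : ℝ) (m n : ℕ) :
    cfAux (θ + m) (n + 1) = cfAux θ (n + 1) := by
  induction n with
  | zero => simp [cfAux]
  | succ n ih => rw [cfAux, ih, ← cfAux]

lemma cfQ_add_natCast (θ : ℝ) (m n : ℕ) : cfQ (θ + m) n = cfQ θ n := by
  induction n using Nat.twoStepInduction with
  | zero => rfl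
  | one => simp only [cfQ, cfA, cfAux_add_natCast_succ]
  | more n h0 h1 => simp only [cfQ, cfA, cfAux_add_natCast_succ, h0, h1]

/-- The denominators obtained when each partial quotient `aₙ₊₂` is chosen equal to `qₙ`. -/
def chainQ : ℕ → ℤ
  | 0 => 1
  | 1 => 1
  | n + 2 => chainQ n * chainQ (n + 1) + chainQ n

/-- The partial quotients with denominators `chainQ`. -/
def chainA : ℕ → ℤ
  | 0 => 1
  | 1 => 1
  | n + 2 => chainQ n

lemma one_le_chainQ (n : ℕ) : 1 ≤ chainQ n := by
  induction n using Nat.twoStepInduction with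
  | zero => exact le_rfl
  | one => exact le_rfl
  | more n h0 h1 =>
    rw [chainQ]
    nlinarith

lemma one_le_chainA : ∀ n, 1 ≤ chainA n
  | 0 => le_rfl
  | 1 => le_rfl
  | n + 2 => one_le_chainQ n

lemma lt_chainQ_two_mul (j : ℕ) : (j : ℤ) < chainQ (2 * j) := by
  induction j with
  | zero => exact one_pos
  | succ j ih =>
    rw [mul_add, mul_one, chainQ]
    push_cast
    nlinarith [one_le_chainQ (2 * j), one_le_chainQ (2 * j + 1)]

lemma chainQ_two_mul_dvd {i j : ℕ} (hij : i ≤ j) : chainQ (2 * i) ∣ chainQ (2 * j) := by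
  induction j, hij using Nat.le_induction with
  | base => exact dvd_rfl
  | succ j _ ih =>
    rw [mul_add, mul_one, chainQ]
    exact dvd_add (ih.mul_right _) ih

lemma cfQ_eq_chainQ {θ : ℝ} (h : ∀ n, cfA θ n = chainA n) (n : ℕ) : cfQ θ n = chainQ n := by
  induction n using Nat.twoStepInduction with
  | zero => rfl
  | one => rw [cfQ, h]; rfl
  | more n h0 h1 => rw [cfQ, h, h0, h1, chainA, chainQ]

/-- The set of irrational real numbers `θ` for which the sequence
`(cᵢ(θ))_{i ≥ 0}` is unbounded — equivalently `c(θ) = ∞`; equivalently, for every integer `M`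
there exist an index `i` and an integer `d > M` such that `d` divides `q_{2j}(θ)` for all
`j ≥ i` — is infinite. -/
theorem stmt_8 :
    {θ : ℝ | Irrational θ ∧
      ∀ M : ℤ, ∃ i : ℕ, ∃ d : ℤ, M < d ∧ ∀ j : ℕ, i ≤ j → d ∣ cfQ θ (2 * j)}.Infinite := by
  obtain ⟨θ, hθ, hA⟩ := exists_irrational_cfA_eq chainA one_le_chainA
  refine Set.infinite_of_injective_forall_mem (f := fun m : ℕ => θ + m) ?_ fun m =>
    ⟨hθ.add_natCast m, fun M => ⟨M.toNat, chainQ (2 * M.toNat), ?_, fun j hj => ?_⟩⟩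
  · intro m n h
    simpa using h
  · exact (Int.self_le_toNat M).trans_lt (lt_chainQ_two_mul _)
  · rw [cfQ_add_natCast, cfQ_eq_chainQ hA]
    exact chainQ_two_mul_dvd hj
end

section
/- Let u, v ∈ ℤ² be primitive vectors (i.e. vectors with coprime coordinates) such that det(u, v) ≥ 2. Then there exist an integer n ≥ 2 and primitive vectors u = λ₀, λ₁, …, λₙ = v in ℤ², each contained in the convex hull of {0, u, v} in ℝ², such that det(λᵢ, λᵢ₊₁) = 1 for all 0 ≤ i ≤ n − 1. -/
/-- A primitive vector `u` with `det(u, v) ≥ 2`, `v` primitive, has a unimodular partner `w`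
with `0 < det(w, v) < det(u, v)`. -/
theorem exists_det_eq_one_and_det_lt (u v : ℤ × ℤ)
    (hu : Int.gcd u.1 u.2 = 1) (hv : Int.gcd v.1 v.2 = 1)
    (hdet : 2 ≤ u.1 * v.2 - u.2 * v.1) :
    ∃ w : ℤ × ℤ, u.1 * w.2 - u.2 * w.1 = 1 ∧ 0 < w.1 * v.2 - w.2 * v.1 ∧
      w.1 * v.2 - w.2 * v.1 < u.1 * v.2 - u.2 * v.1 := by
  obtain ⟨x, y, hxy⟩ := Int.isCoprime_iff_gcd_eq_one.mpr hu
  obtain ⟨a, b, hab⟩ := Int.isCoprime_iff_gcd_eq_one.mpr hv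
  set d := u.1 * v.2 - u.2 * v.1 with hd
  set e := -y * v.2 - x * v.1 with he
  have hmod := Int.emod_add_mul_ediv e d
  have hnonneg : 0 ≤ e % d := Int.emod_nonneg e (by lia)
  have hlt : e % d < d := Int.emod_lt_of_pos e (by lia)
  set t := e / d
  have hwv : (-y - t * u.1) * v.2 - (x - t * u.2) * v.1 = e % d := by
    linear_combination -hmod - he + t * hd
  have huw : u.1 * (x - t * u.2) - u.2 * (-y - t * u.1) = 1 := by
    linear_combination hxy
  refine ⟨(-y - t * u.1, x - t * u.2), huw, ?_, by simpa only [hwv] using hlt⟩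
  simp only [hwv]
  refine lt_of_le_of_ne hnonneg fun h0 => ?_
  rw [← h0] at hwv
  generalize -y - t * u.1 = p at hwv huw
  generalize x - t * u.2 = q at hwv huw
  have hdvd : d ∣ 1 := ⟨a * p + b * q, by
    linear_combination -huw + (a * p + b * q) * hd
      - (a * u.1 + b * u.2) * hwv + (u.2 * p - u.1 * q) * hab⟩
  have := Int.le_of_dvd one_pos hdvd
  lia

/-- If `det(u, w) = 1` and `0 < det(w, v) < det(u, v)`, then `w` lies in the triangle with
vertices `0`, `u`, `v`. -/
theorem mem_convexHull_of_det_eq_one (u v w : ℤ × ℤ)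
    (huw : u.1 * w.2 - u.2 * w.1 = 1) (hpos : 0 < w.1 * v.2 - w.2 * v.1)
    (hlt : w.1 * v.2 - w.2 * v.1 < u.1 * v.2 - u.2 * v.1) :
    ((w.1 : ℝ), (w.2 : ℝ)) ∈
      convexHull ℝ ({(0, 0), ((u.1 : ℝ), (u.2 : ℝ)), ((v.1 : ℝ), (v.2 : ℝ))} : Set (ℝ × ℝ)) := by
  have hle : w.1 * v.2 - w.2 * v.1 + 1 ≤ u.1 * v.2 - u.2 * v.1 := hlt
  have huwR : (u.1 * w.2 - u.2 * w.1 : ℝ) = 1 := mod_cast huw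
  have hposR : (0 : ℝ) < w.1 * v.2 - w.2 * v.1 := mod_cast hpos
  have hleR : (w.1 * v.2 - w.2 * v.1 + 1 : ℝ) ≤ u.1 * v.2 - u.2 * v.1 := mod_cast hle
  set k : ℝ := w.1 * v.2 - w.2 * v.1 with hk
  set d : ℝ := u.1 * v.2 - u.2 * v.1 with hd
  have hd0 : 0 < d := by linarith
  rw [convexHull_insert (by simp), convexHull_pair]
  simp only [convexJoin_singleton_left, Set.mem_iUnion]
  have hk1 : 0 < k + 1 := by linarith
  refine ⟨(k / (k + 1)) • ((u.1 : ℝ), (u.2 : ℝ)) + (1 / (k + 1)) • ((v.1 : ℝ), (v.2 : ℝ)),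
    ⟨k / (k + 1), 1 / (k + 1), by positivity, by positivity, by field_simp, rfl⟩,
    1 - (k + 1) / d, (k + 1) / d, ?_, by positivity, by ring, ?_⟩
  · rw [sub_nonneg, div_le_one hd0]
    exact hleR
  · ext
    · simp
      field_simp
      linear_combination u.1 * hk - w.1 * hd - v.1 * huwR
    · simp
      field_simp
      linear_combination u.2 * hk - w.2 * hd - v.2 * huwR

/-- Two primitive vectors with positive determinant are joined by a unimodular chain of primitive
vectors inside the triangle they span with the origin. -/
theorem exists_unimodular_chain (v : ℤ × ℤ) (hv : Int.gcd v.1 v.2 = 1) (m : ℕ) :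
    ∀ u : ℤ × ℤ, Int.gcd u.1 u.2 = 1 → 0 < u.1 * v.2 - u.2 * v.1 →
      u.1 * v.2 - u.2 * v.1 ≤ m →
    ∃ n : ℕ, ∃ lam : ℕ → ℤ × ℤ, lam 0 = u ∧ lam n = v ∧
      (∀ i ≤ n, Int.gcd (lam i).1 (lam i).2 = 1 ∧
        (((lam i).1 : ℝ), ((lam i).2 : ℝ)) ∈
          convexHull ℝ ({(0, 0), ((u.1 : ℝ), (u.2 : ℝ)), ((v.1 : ℝ), (v.2 : ℝ))} : Set (ℝ × ℝ))) ∧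
      ∀ i < n, (lam i).1 * (lam (i + 1)).2 - (lam i).2 * (lam (i + 1)).1 = 1 := by
  induction m with
  | zero => intro u _ hpos hle; lia
  | succ m ih =>
    intro u hu hpos hle
    have hmem : ∀ x ∈ ({(0, 0), ((u.1 : ℝ), (u.2 : ℝ)), ((v.1 : ℝ), (v.2 : ℝ))} : Set (ℝ × ℝ)),
        x ∈ convexHull ℝ
          ({(0, 0), ((u.1 : ℝ), (u.2 : ℝ)), ((v.1 : ℝ), (v.2 : ℝ))} : Set (ℝ × ℝ)) :=
      fun x hx => subset_convexHull ℝ _ hx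
    by_cases h1 : u.1 * v.2 - u.2 * v.1 = 1
    · refine ⟨1, fun i => if i = 0 then u else v, by simp, by simp, fun i _ => ?_, fun i hi => ?_⟩
      · by_cases hi : i = 0
        · simpa only [hi, if_true] using ⟨hu, hmem _ (by simp)⟩
        · simpa only [hi, if_false] using ⟨hv, hmem _ (by simp)⟩
      · obtain rfl : i = 0 := by lia
        simpa using h1
    · obtain ⟨w, huw, hwpos, hwlt⟩ := exists_det_eq_one_and_det_lt u v hu hv (by lia)
      have hw : Int.gcd w.1 w.2 = 1 :=
        Int.isCoprime_iff_gcd_eq_one.mp ⟨-u.2, u.1, by linear_combination huw⟩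
      obtain ⟨n, lam, h0, hn, hlam, hstep⟩ := ih w hw hwpos (by push_cast at hle; lia)
      refine ⟨n + 1, fun i => Nat.casesOn i u lam, rfl, hn, ?_, ?_⟩
      · rintro (_ | i) hi
        · exact ⟨hu, hmem _ (by simp)⟩
        · obtain ⟨hgcd, hhull⟩ := hlam i (by lia)
          refine ⟨hgcd, convexHull_min ?_ (convex_convexHull ℝ _) hhull⟩
          rintro x (rfl | rfl | rfl)
          · exact hmem _ (by simp)
          · exact mem_convexHull_of_det_eq_one u v w huw hwpos hwlt
          · exact hmem _ (by simp)
      · rintro (_ | i) hi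
        · simpa [h0] using huw
        · exact hstep i (by lia)

/-- Let `u, v ∈ ℤ²` be primitive vectors with `det(u, v) ≥ 2`. Then there
exist `n ≥ 2` and primitive vectors `u = λ₀, λ₁, …, λₙ = v` in `ℤ²`, each contained in the
convex hull of `{0, u, v}` in `ℝ²`, such that `det(λᵢ, λᵢ₊₁) = 1` for all `0 ≤ i ≤ n − 1`. -/
theorem stmt_9 (u v : ℤ × ℤ)
    (hu : Int.gcd u.1 u.2 = 1) (hv : Int.gcd v.1 v.2 = 1)
    (hdet : 2 ≤ u.1 * v.2 - u.2 * v.1) :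
    ∃ n : ℕ, 2 ≤ n ∧ ∃ lam : ℕ → ℤ × ℤ, lam 0 = u ∧ lam n = v ∧
      (∀ i ≤ n, Int.gcd (lam i).1 (lam i).2 = 1 ∧
        (((lam i).1 : ℝ), ((lam i).2 : ℝ)) ∈
          convexHull ℝ ({(0, 0), ((u.1 : ℝ), (u.2 : ℝ)), ((v.1 : ℝ), (v.2 : ℝ))} : Set (ℝ × ℝ))) ∧
      ∀ i < n, (lam i).1 * (lam (i + 1)).2 - (lam i).2 * (lam (i + 1)).1 = 1 := by
  obtain ⟨n, lam, h0, hn, hlam, hstep⟩ := exists_unimodular_chain v hv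
    (u.1 * v.2 - u.2 * v.1).toNat u hu (by lia) (Int.self_le_toNat _)
  refine ⟨n, ?_, lam, h0, hn, hlam, hstep⟩
  by_contra! hlt
  obtain rfl | rfl : n = 0 ∨ n = 1 := by lia
  · rw [← h0, ← hn, mul_comm (lam 0).2] at hdet
    lia
  · have := hstep 0 one_pos
    rw [zero_add, h0, hn] at this
    lia
end

section
/- Let A be a small abelian category and let F, G : ℕ ⥤ A be functors such that every transition morphism F(n) → F(n+1) is a monomorphism in A. Then a morphism f : ⟨F⟩ → ⟨G⟩ in Ind(A) is a monomorphism if and only if for every n ∈ ℕ the composite ιₙ^F ≫ f : y(F(n)) → ⟨G⟩ is a monomorphism in Ind(A). -/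
open CategoryTheory Limits

/-- A functor out of `ℕ` whose successor transition morphisms are monomorphisms maps every
morphism to a monomorphism. -/
lemma CategoryTheory.Functor.mono_map_of_mono_map_succ {C : Type*} [Category* C] (F : ℕ ⥤ C)
    (hF : ∀ n : ℕ, Mono (F.map (homOfLE (Nat.le_succ n)))) {i j : ℕ} (φ : i ⟶ j) :
    Mono (F.map φ) := by
  have key : ∀ (j : ℕ) (h : i ≤ j), Mono (F.map (homOfLE h)) := by
    intro j h
    induction j, h using Nat.le_induction with
    | base =>
      rw [Subsingleton.elim (homOfLE le_rfl) (𝟙 i), F.map_id]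
      infer_instance
    | succ k hk ih =>
      rw [Subsingleton.elim (homOfLE _) (homOfLE hk ≫ homOfLE (Nat.le_succ k)), F.map_comp]
      have := hF k
      infer_instance
  exact key j (leOfHom φ)

/-- If `colim : (J ⥤ C) ⥤ C` preserves monomorphisms and `J` is connected, a morphism out of a
colimit of shape `J` is a monomorphism as soon as its restrictions along the coprojections are. -/
lemma CategoryTheory.Limits.IsColimit.mono_of_mono_ι_comp {C J : Type*} [Category* C]
    [Category* J] [IsConnected J] [HasColimitsOfShape J C]
    [(colim : (J ⥤ C) ⥤ C).PreservesMonomorphisms] {X : J ⥤ C} {c : Cocone X}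
    (hc : IsColimit c) {Y : C} (f : c.pt ⟶ Y) (hf : ∀ j, Mono (c.ι.app j ≫ f)) : Mono f := by
  let φ : X ⟶ (Functor.const J).obj Y := (c.extend f).ι
  have : ∀ j, Mono (φ.app j) := hf
  have := NatTrans.mono_of_mono_app φ
  exact colim.map_mono' φ hc (isColimitConstCocone J Y) f fun j ↦ (Category.comp_id _).symm

/-- Let `A` be a small abelian category and `F, G : ℕ ⥤ A` with every
transition morphism `F(n) → F(n+1)` a monomorphism in `A`. Then a morphism `f : ⟨F⟩ → ⟨G⟩` in
`Ind A` is a monomorphism if and only if for every `n` the composite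
`ιₙ^F ≫ f : y(F(n)) → ⟨G⟩` with the colimit coprojection is a monomorphism in `Ind A`. -/
theorem stmt_13 {A : Type} [SmallCategory A] [Abelian A] (F G : ℕ ⥤ A)
    (hF : ∀ n : ℕ, Mono (F.map (homOfLE (Nat.le_succ n))))
    (f : colimit (F ⋙ Ind.yoneda) ⟶ colimit (G ⋙ Ind.yoneda)) :
    Mono f ↔ ∀ n : ℕ, Mono (colimit.ι (F ⋙ Ind.yoneda) n ≫ f) := by
  constructor
  · intro _ n
    have (i j : ℕ) (φ : i ⟶ j) : Mono ((F ⋙ Ind.yoneda).map φ) :=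
      have := F.mono_map_of_mono_map_succ hF φ
      inferInstanceAs (Mono (Ind.yoneda.map (F.map φ)))
    have : Mono (colimit.ι (F ⋙ Ind.yoneda) n) :=
      (colimit.isColimit (F ⋙ Ind.yoneda)).mono_ι_app_of_isFiltered n
    infer_instance
  · intro h
    have : IsConnected ℕ := IsFiltered.isConnected ℕ
    exact (colimit.isColimit (F ⋙ Ind.yoneda)).mono_of_mono_ι_comp f h
end

section
/- Let θ be irrational and suppose there exists an integer M such that aₙ(θ) ≤ M for all n ≥ 1 (i.e. the partial quotients of θ are bounded by M). Then for every i ≥ 0, cᵢ(θ) divides a_{2i+2}(θ), so in particular cᵢ(θ) ≤ M; consequently c(θ) is finite and c(θ) ≤ M. -/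
open Filter

/-- The sequence `j ↦ gcd(q_{2i}, q_{2i+2}, …, q_{2j})` of gcds of even-indexed convergent
denominators of `θ`. -/
noncomputable def cfGcdSeq (θ : ℝ) (i j : ℕ) : ℕ :=
  Finset.gcd (Finset.Icc i j) (fun k => (cfQ θ (2 * k)).natAbs)

/-- `cᵢ(θ)`: the stable value of the (eventually constant) sequence
`j ↦ gcd(q_{2i}, q_{2i+2}, …, q_{2j})`, realized as its `liminf` as `j → ∞`. -/
noncomputable def cfCI (θ : ℝ) (i : ℕ) : ℕ := Filter.liminf (cfGcdSeq θ i) Filter.atTop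

theorem irrational_cfAux {θ : ℝ} (hθ : Irrational θ) (n : ℕ) : Irrational (cfAux θ n) := by
  induction n with
  | zero => exact hθ
  | succ n ih => exact (ih.sub_intCast ⌊cfAux θ n⌋).inv

theorem cfA_succ_pos {θ : ℝ} (hθ : Irrational θ) (n : ℕ) : 0 < cfA θ (n + 1) := by
  have hne : Int.fract (cfAux θ n) ≠ 0 :=
    ((irrational_cfAux hθ n).sub_intCast ⌊cfAux θ n⌋).ne_zero
  have hpos : 0 < Int.fract (cfAux θ n) := lt_of_le_of_ne (Int.fract_nonneg _) hne.symm
  exact Int.floor_pos.mpr ((one_le_inv₀ hpos).mpr (Int.fract_lt_one _).le)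

theorem cfQ_pos {θ : ℝ} (hθ : Irrational θ) : ∀ n : ℕ, 0 < cfQ θ n
  | 0 => by simp [cfQ]
  | 1 => cfA_succ_pos hθ 0
  | n + 2 => by
    have ha := cfA_succ_pos hθ (n + 1)
    have h0 := cfQ_pos hθ n
    have h1 := cfQ_pos hθ (n + 1)
    rw [cfQ]
    positivity

theorem Antitone.exists_forall_ge_eq {f : ℕ → ℕ} (hf : Antitone f) :
    ∃ n, ∀ m, n ≤ m → f m = f n :=
  ⟨Function.argmin f, fun _ hm => le_antisymm (hf hm) (Function.argmin_le f _)⟩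

theorem dvd_cfGcdSeq_iff (θ : ℝ) (i j d : ℕ) :
    d ∣ cfGcdSeq θ i j ↔ ∀ k, i ≤ k → k ≤ j → (d : ℤ) ∣ cfQ θ (2 * k) := by
  simp [cfGcdSeq, Finset.dvd_gcd_iff, Int.natCast_dvd]

theorem dvd_cfCI_iff {θ : ℝ} (hθ : Irrational θ) (i d : ℕ) :
    d ∣ cfCI θ i ↔ ∀ k, i ≤ k → (d : ℤ) ∣ cfQ θ (2 * k) := by
  have hpos (n : ℕ) : 0 < cfGcdSeq θ i (i + n) := by
    refine Nat.pos_of_ne_zero fun h => (cfQ_pos hθ (2 * i)).ne' ?_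
    have := (dvd_cfGcdSeq_iff θ i (i + n) 0).mp (by simp [h]) i le_rfl (by omega)
    simpa using this
  have hanti : Antitone fun n => cfGcdSeq θ i (i + n) := fun m n hmn =>
    Nat.le_of_dvd (hpos m) ((dvd_cfGcdSeq_iff θ i _ _).mpr fun k hik hkm =>
      (dvd_cfGcdSeq_iff θ i (i + n) _).mp dvd_rfl k hik (by omega))
  obtain ⟨N, hN⟩ := hanti.exists_forall_ge_eq
  have hstable (j : ℕ) (hj : i + N ≤ j) : cfGcdSeq θ i j = cfGcdSeq θ i (i + N) := by
    have := hN (j - i) (by omega)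
    simpa [show i + (j - i) = j by omega] using this
  have hC : cfCI θ i = cfGcdSeq θ i (i + N) := by
    rw [cfCI, liminf_congr (eventually_atTop.mpr ⟨i + N, hstable⟩), liminf_const]
  rw [hC]
  constructor
  · intro hd k hik
    rw [← hstable (max k (i + N)) (le_max_right _ _)] at hd
    exact (dvd_cfGcdSeq_iff θ i _ _).mp hd k hik (le_max_left _ _)
  · exact fun h => (dvd_cfGcdSeq_iff θ i _ _).mpr fun k hik _ => h k hik

theorem cfCI_dvd_cfA {θ : ℝ} (hθ : Irrational θ) (i : ℕ) :
    (cfCI θ i : ℤ) ∣ cfA θ (2 * i + 2) := by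
  have h := (dvd_cfCI_iff hθ i _).mp dvd_rfl
  have h0 := h i le_rfl
  have h1 := h (i + 1) i.le_succ
  rw [show 2 * (i + 1) = 2 * i + 2 by ring, cfQ, dvd_add_left h0] at h1
  exact ((isCoprime_cfQ_succ θ (2 * i)).of_isCoprime_of_dvd_left h0).dvd_of_dvd_mul_right h1

theorem monotone_cfCI {θ : ℝ} (hθ : Irrational θ) : Monotone (cfCI θ) := by
  refine monotone_nat_of_le_succ fun i => Nat.le_of_dvd ?_ ?_
  · refine Nat.pos_of_ne_zero fun h => (cfA_succ_pos hθ (2 * (i + 1) + 1)).ne' ?_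
    simpa [h] using cfCI_dvd_cfA hθ (i + 1)
  · exact (dvd_cfCI_iff hθ (i + 1) _).mpr fun k hk =>
      (dvd_cfCI_iff hθ i _).mp dvd_rfl k (by omega)

/-- Let `θ` be irrational with partial quotients `aₙ(θ) ≤ M` for all `n ≥ 1`.
Then for every `i ≥ 0`, `cᵢ(θ)` divides `a_{2i+2}(θ)`, so in particular `cᵢ(θ) ≤ M`;
consequently `c(θ)` is finite (the sequence `(cᵢ(θ))ᵢ` is eventually constant) and
`c(θ) ≤ M`. -/
theorem stmt_16 (θ : ℝ) (hθ : Irrational θ) (M : ℤ)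
    (hM : ∀ n : ℕ, 1 ≤ n → cfA θ n ≤ M) :
    (∀ i : ℕ, (cfCI θ i : ℤ) ∣ cfA θ (2 * i + 2)) ∧
    (∀ i : ℕ, (cfCI θ i : ℤ) ≤ M) ∧
    (∃ c : ℕ, (c : ℤ) ≤ M ∧ ∀ᶠ i in atTop, cfCI θ i = c) := by
  have hle (i : ℕ) : (cfCI θ i : ℤ) ≤ M :=
    (Int.le_of_dvd (cfA_succ_pos hθ _) (cfCI_dvd_cfA hθ i)).trans (hM _ (by omega))
  refine ⟨cfCI_dvd_cfA hθ, hle, ?_⟩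
  have hanti : Antitone fun i => M.toNat - cfCI θ i := fun i j hij =>
    Nat.sub_le_sub_left (monotone_cfCI hθ hij) _
  obtain ⟨N, hN⟩ := hanti.exists_forall_ge_eq
  refine ⟨cfCI θ N, hle N, eventually_atTop.mpr ⟨N, fun m hm => ?_⟩⟩
  have h := hN m hm
  have hm' := hle m
  have hN' := hle N
  omega
end
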